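/- There exists a subset T of F_2^6 of cardinality exactly 8 such that every subset of T consisting of exactly 4 vectors is linearly independent over F_2; hence 8 is the maximal possible cardinality of a subset of F_2^6 all of whose 4-element subsets are linearly independent. -/

import Mathlib

/-- Hamming weight of a binary vector, as a natural number. -/
def wtt {n : ℕ} (f : Fin n → ZMod 2) : ℕ := ∑ i, (f i).val

theorem wtt_eq_card {n : ℕ} (f : Fin n → ZMod 2) :
    wtt f = (Finset.univ.filter (fun i => f i ≠ 0)).card := by
  rw [wtt, Finset.card_filter]
  refine Finset.sum_congr rfl fun i _ => ?_
  generalize f i = x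
  revert x
  decide

/-- No three independent words of length 9 span a code of minimum distance 5. -/
theorem no_code (a b c : Fin 9 → ZMod 2) (h1 : 5 ≤ wtt a) (h2 : 5 ≤ wtt b) (h3 : 5 ≤ wtt c)
    (h4 : 5 ≤ wtt (a + b)) (h5 : 5 ≤ wtt (a + c)) (h6 : 5 ≤ wtt (b + c))
    (h7 : 5 ≤ wtt (a + b + c)) : False := by
  have e2 : ∀ f g : Fin 9 → ZMod 2, wtt (f + g) + 2 * wtt (f * g) = wtt f + wtt g := by
    intro f g
    simp only [wtt, Finset.mul_sum, ← Finset.sum_add_distrib]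
    refine Finset.sum_congr rfl fun i _ => ?_
    simp only [Pi.add_apply, Pi.mul_apply]
    generalize f i = x
    generalize g i = y
    revert x y
    decide
  have e3 : wtt (a + b + c) + 2 * wtt (a * b) + 2 * wtt (a * c) + 2 * wtt (b * c)
      = wtt a + wtt b + wtt c + 4 * wtt (a * b * c) := by
    simp only [wtt, Finset.mul_sum, ← Finset.sum_add_distrib]
    refine Finset.sum_congr rfl fun i _ => ?_
    simp only [Pi.add_apply, Pi.mul_apply]
    generalize a i = x
    generalize b i = y
    generalize c i = z
    revert x y z
    decide
  have e4 : wtt a + wtt b + wtt c + wtt (a * b * c)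
      ≤ 9 + wtt (a * b) + wtt (a * c) + wtt (b * c) := by
    have h9 : ∑ _i : Fin 9, 1 = 9 := by simp
    refine le_of_le_of_eq (b := (∑ _i : Fin 9, 1) + wtt (a * b) + wtt (a * c) + wtt (b * c)) ?_
      (by rw [h9])
    simp only [wtt, ← Finset.sum_add_distrib]
    refine Finset.sum_le_sum fun i _ => ?_
    simp only [Pi.mul_apply]
    generalize a i = x
    generalize b i = y
    generalize c i = z
    revert x y z
    decide
  have eab := e2 a b
  have eac := e2 a c
  have ebc := e2 b c
  rcases Nat.even_or_odd' (wtt a) with ⟨p, hp | hp⟩ <;>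
  rcases Nat.even_or_odd' (wtt b) with ⟨q, hq | hq⟩ <;>
  rcases Nat.even_or_odd' (wtt c) with ⟨r, hr | hr⟩ <;> omega

theorem upper (e : Fin 9 ↪ (Fin 6 → ZMod 2))
    (h : ∀ S : Finset (Fin 9), S.card = 4 → LinearIndepOn (ZMod 2) e (S : Set (Fin 9))) :
    False := by
  let L := Fintype.linearCombination (ZMod 2) (e : Fin 9 → (Fin 6 → ZMod 2))
  have hw : ∀ f ∈ LinearMap.ker L, f ≠ 0 → 5 ≤ wtt f := by
    intro f hf hne
    by_contra hlt
    rw [wtt_eq_card] at hlt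
    obtain ⟨S, hS, hc⟩ := Finset.exists_superset_card_eq
      (s := Finset.univ.filter (fun i => f i ≠ 0)) (n := 4) (by omega) (by simp)
    have hz : ∀ i, i ∉ S → f i = 0 := by
      intro i hi
      by_contra h0
      exact hi (hS (by simp [h0]))
    have hi := linearIndepOn_finset_iff.1 (h S hc) f (by
      have : ∑ i, f i • e i = 0 := by
        simpa [L, Fintype.linearCombination_apply] using hf
      rw [← this]
      exact Finset.sum_subset (Finset.subset_univ _) fun i _ hi => by simp [hz i hi])
    apply hne
    funext i
    by_cases hiS : i ∈ S
    · exact hi i hiS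
    · exact hz i hiS
  have hrk : 3 ≤ Module.finrank (ZMod 2) (LinearMap.ker L) := by
    have h1 := LinearMap.finrank_range_add_finrank_ker L
    have h2 := Submodule.finrank_le (LinearMap.range L)
    simp only [Module.finrank_fin_fun] at h1 h2
    omega
  obtain ⟨v, hv⟩ := exists_linearIndependent_of_le_finrank hrk
  have key : ∀ x y z : ZMod 2, (x ≠ 0 ∨ y ≠ 0 ∨ z ≠ 0) →
      5 ≤ wtt ((x • v 0 + y • v 1 + z • v 2 : LinearMap.ker L) : Fin 9 → ZMod 2) := by
    intro x y z hxyz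
    refine hw _ (Subtype.property _) fun h0 => ?_
    have h0' : x • v 0 + y • v 1 + z • v 2 = 0 := Subtype.ext h0
    have := Fintype.linearIndependent_iff.1 hv ![x, y, z] (by
      simpa [Fin.sum_univ_three] using h0')
    have h0 := this 0
    have h1 := this 1
    have h2 := this 2
    simp at h0 h1 h2
    simp [h0, h1, h2] at hxyz
  refine no_code (v 0) (v 1) (v 2) ?_ ?_ ?_ ?_ ?_ ?_ ?_
  · simpa using key 1 0 0 (by simp)
  · simpa using key 0 1 0 (by simp)
  · simpa using key 0 0 1 (by simp)
  · simpa using key 1 1 0 (by simp)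
  · simpa using key 1 0 1 (by simp)
  · simpa using key 0 1 1 (by simp)
  · simpa using key 1 1 1 (by simp)

/-- The eight vectors. -/
def vecs : Fin 8 → (Fin 6 → ZMod 2) :=
  ![![1,0,0,0,0,0], ![0,1,0,0,0,0], ![0,0,1,0,0,0], ![0,0,0,1,0,0], ![0,0,0,0,1,0],
    ![0,0,0,0,0,1], ![1,1,1,1,0,0], ![1,1,1,0,1,1]]

theorem vecs_inj : Function.Injective vecs := by
  decide

theorem vecs_wt (f : Fin 8 → ZMod 2) (h : ∑ i, f i • vecs i = 0) (hw : wtt f ≤ 4) : f = 0 := by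
  have key : ∀ s t a b c d p q : ZMod 2, a + s + t = 0 → b + s + t = 0 → c + s + t = 0 →
      d + s = 0 → p + t = 0 → q + t = 0 →
      a.val + b.val + c.val + d.val + p.val + q.val + s.val + t.val ≤ 4 → s = 0 ∧ t = 0 := by
    intro s t a b c d p q ha hb hc hd hp hq
    have z : ∀ x y : ZMod 2, x + y = 0 → x = y := by decide
    rw [add_assoc] at ha hb hc
    rw [z _ _ ha, z _ _ hb, z _ _ hc, z _ _ hd, z _ _ hp, z _ _ hq]
    clear ha hb hc hd hp hq z
    revert s t
    decide
  have h0 := congrFun h 0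
  have h1 := congrFun h 1
  have h2 := congrFun h 2
  have h3 := congrFun h 3
  have h4 := congrFun h 4
  have h5 := congrFun h 5
  simp [Fin.sum_univ_eight, vecs] at h0 h1 h2 h3 h4 h5
  simp only [wtt, Fin.sum_univ_eight] at hw
  obtain ⟨hs, ht⟩ := key _ _ _ _ _ _ _ _ h0 h1 h2 h3 h4 h5 hw
  simp only [hs, ht, add_zero] at h0 h1 h2 h3 h4 h5
  funext i
  fin_cases i <;> assumption

/-- There exists a subset of `F₂^6` of cardinality exactly 8 all of whose 4-element
subsets are linearly independent over `F₂`; moreover 8 is the maximal possible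
cardinality of such a subset. -/
theorem isGreatest_card_all_four_subsets_linearIndependent :
    IsGreatest
      {n : ℕ | ∃ T : Finset (Fin 6 → ZMod 2), T.card = n ∧
        ∀ S ⊆ T, S.card = 4 →
          LinearIndependent (ZMod 2) (fun v : S => (v : Fin 6 → ZMod 2))}
      8 := by
  constructor
  · refine ⟨Finset.univ.map ⟨vecs, vecs_inj⟩, by simp, ?_⟩
    intro S hS hc
    obtain ⟨U, -, rfl⟩ := Finset.subset_map_iff.1 hS
    rw [Finset.card_map] at hc
    rw [Fintype.linearIndependent_iff]
    intro g hg
    let f : Fin 8 → ZMod 2 := fun i =>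
      if h : i ∈ U then g ⟨vecs i, Finset.mem_map_of_mem ⟨vecs, vecs_inj⟩ h⟩ else 0
    have hf : f = 0 := by
      apply vecs_wt
      · let G : (Fin 6 → ZMod 2) → ZMod 2 := fun v =>
          if h : v ∈ U.map ⟨vecs, vecs_inj⟩ then g ⟨v, h⟩ else 0
        have hG : ∑ v ∈ U.map ⟨vecs, vecs_inj⟩, G v • v = 0 := by
          rw [← hg, ← Finset.sum_coe_sort]
          refine Finset.sum_congr rfl fun v _ => ?_
          have : G v = g v := dif_pos v.2
          rw [this]
        rw [Finset.sum_map] at hG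
        rw [← hG]
        symm
        refine (Finset.sum_congr rfl fun i hi => ?_).trans
          (Finset.sum_subset (Finset.subset_univ U) fun i _ hi => ?_)
        · have h1 : G (vecs i) = f i := by
            simp only [G, f]
            rw [dif_pos hi]
            exact dif_pos (Finset.mem_map_of_mem ⟨vecs, vecs_inj⟩ hi)
          exact congrArg (· • vecs i) h1
        · have : f i = 0 := dif_neg hi
          rw [this, zero_smul]
      · rw [wtt_eq_card, ← hc]
        apply Finset.card_le_card
        intro i hi
        by_contra hn
        have : f i = 0 := dif_neg hn
        simp [this] at hi
    rintro ⟨v, hv⟩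
    obtain ⟨i, hi, rfl⟩ := Finset.mem_map.1 hv
    have := congrFun hf i
    simp only [f] at this
    rw [dif_pos hi] at this
    exact this
  · rintro n ⟨T, rfl, hT⟩
    by_contra hlt
    obtain ⟨T', hT', hc⟩ := Finset.exists_subset_card_eq (s := T) (n := 9) (by omega)
    let e : Fin 9 ↪ (Fin 6 → ZMod 2) :=
      (T'.equivFinOfCardEq hc).symm.toEmbedding.trans (Function.Embedding.subtype _)
    refine upper e fun S hS => ?_
    have hl := hT (S.map e) (by
      intro v hv
      obtain ⟨i, _, rfl⟩ := Finset.mem_map.1 hv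
      exact hT' ((T'.equivFinOfCardEq hc).symm i).2) (by simpa using hS)
    exact hl.comp (fun i : (S : Set (Fin 9)) => ⟨e i, Finset.mem_map_of_mem e i.2⟩)
      (fun i j hij => by
        have h1 : e i = e j := Subtype.mk.inj hij
        exact Subtype.ext (e.injective h1))
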